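/- Necessary conditions for SUTVA (Proposition 1). Assume Assumptions IV and SM hold, and assume SUTVA: almost surely D_i(z,1) = D_i(z,0) for each z ∈ {0,1}. Then Δ^{01}_{00}E[D_i] = P(S_i ∪ P_i) = 0 and Δ^{11}_{10}E[D_i] = P(P_i ∪ G_i) = 0, where S_i, P_i, G_i are the social-complier, peer-complier and group-complier events. -/

import Mathlib

open MeasureTheory ProbabilityTheory

noncomputable section

/-- Real value of a Boolean indicator. -/
def b2r (b : Bool) : ℝ := if b then 1 else 0

variable {Ω : Type*} {m : ℕ}

/-- Conditional expectation of `X` given the event `A`, i.e. `E[X·1_A]/P(A)`. -/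
def cexp [MeasurableSpace Ω] (P : Measure Ω) (X : Ω → ℝ) (A : Set Ω) : ℝ :=
  (∫ ω in A, X ω ∂P) / (P A).toReal

/-- The event `{Z_i = z, Z_{(i)} = z'}` (all peer instruments equal `z'`). -/
def ZevM (Zi : Ω → Bool) (Zp : Ω → Fin m → Bool) (z z' : Bool) : Set Ω :=
  {ω | Zi ω = z ∧ ∀ j, Zp ω j = z'}

/-- `Δ^{zz'}_{ww'} E[X]`, where `X z z'` is the observed quantity under the
instrument pattern `(z, z')`. -/
def dEM [MeasurableSpace Ω] (P : Measure Ω) (Zi : Ω → Bool) (Zp : Ω → Fin m → Bool)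
    (X : Bool → Bool → Ω → ℝ) (z z' w w' : Bool) : ℝ :=
  cexp P (X z z') (ZevM Zi Zp z z') - cexp P (X w w') (ZevM Zi Zp w w')

theorem setIntegral_b2r [MeasurableSpace Ω] (P : Measure Ω) {D : Ω → Bool} (hD : Measurable D)
    (A : Set Ω) : ∫ ω in A, b2r (D ω) ∂P = P.real (A ∩ D ⁻¹' {true}) := by
  have hm : MeasurableSet (D ⁻¹' {true}) := hD (measurableSet_singleton _)
  have h : (fun ω => b2r (D ω)) = (D ⁻¹' {true}).indicator 1 := by
    funext ω
    cases hω : D ω <;> simp [b2r, Set.indicator, hω]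
  rw [h, integral_indicator_one hm, measureReal_restrict_apply hm, Set.inter_comm]

/-- Conditioning on an instrument event does not change the mean of a potential treatment that is
independent of the instruments. -/
theorem cexp_b2r_of_indepFun [MeasurableSpace Ω] (P : Measure Ω) [IsProbabilityMeasure P]
    {Zi : Ω → Bool} {Zp : Ω → Fin m → Bool} {D : Ω → Bool} (hD : Measurable D)
    (hIndep : IndepFun (fun ω => (Zi ω, Zp ω)) D P) (z z' : Bool)
    (hpos : 0 < P (ZevM Zi Zp z z')) :
    cexp P (fun ω => b2r (D ω)) (ZevM Zi Zp z z') = P.real (D ⁻¹' {true}) := by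
  have hA : ZevM Zi Zp z z' = (fun ω => (Zi ω, Zp ω)) ⁻¹' {(z, fun _ => z')} := by
    ext ω
    simp [ZevM, funext_iff]
  have hmul := hIndep.measure_inter_preimage_eq_mul _ _
    (measurableSet_singleton (z, fun _ => z')) (measurableSet_singleton true)
  rw [← hA] at hmul
  have hne : (P (ZevM Zi Zp z z')).toReal ≠ 0 :=
    (ENNReal.toReal_pos hpos.ne' (measure_ne_top _ _)).ne'
  rw [cexp, setIntegral_b2r P hD, measureReal_def, hmul, ENNReal.toReal_mul, measureReal_def,
    mul_div_cancel_left₀ _ hne]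

theorem dEM_b2r_eq_zero [MeasurableSpace Ω] (P : Measure Ω) [IsProbabilityMeasure P]
    {Zi : Ω → Bool} {Zp : Ω → Fin m → Bool} {D : Bool → Bool → Ω → Bool}
    (hD : ∀ z z', Measurable (D z z'))
    (hIndep : ∀ z z', IndepFun (fun ω => (Zi ω, Zp ω)) (D z z') P)
    (hpos : ∀ z z', 0 < P (ZevM Zi Zp z z')) {z z' w w' : Bool}
    (h : D z z' =ᵐ[P] D w w') :
    dEM P Zi Zp (fun z z' ω => b2r (D z z' ω)) z z' w w' = 0 := by
  rw [dEM, cexp_b2r_of_indepFun P (hD z z') (hIndep z z') z z' (hpos z z'),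
    cexp_b2r_of_indepFun P (hD w w') (hIndep w w') w w' (hpos w w'), sub_eq_zero]
  refine measureReal_congr ?_
  filter_upwards [h] with ω hω
  exact congrArg (· ∈ ({true} : Set Bool)) hω

/-- Proposition 1: necessary conditions for SUTVA. -/
theorem sutva_necessary_conditions
    [MeasurableSpace Ω] (P : Measure Ω) [IsProbabilityMeasure P]
    (m : ℕ) (hm : 1 ≤ m)
    (Zi : Ω → Bool) (Zp : Ω → Fin m → Bool)
    (Di : Bool → Bool → Ω → Bool) (Dp : Bool → Bool → Ω → Fin m → Bool)
    (Y : Bool → (Fin m → Bool) → Ω → ℝ)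
    (hZi : Measurable Zi) (hZp : Measurable Zp)
    (hDi : ∀ z z', Measurable (Di z z')) (hDp : ∀ z z', Measurable (Dp z z'))
    (hYm : ∀ d dp, Measurable (Y d dp)) (hYint : ∀ d dp, Integrable (Y d dp) P)
    (hZpos : ∀ z z', 0 < P (ZevM Zi Zp z z'))
    -- Assumption IV: independence and own-instrument monotonicity
    (hIndep : IndepFun (fun ω => (Zi ω, Zp ω))
      (fun ω => (fun z z' => Di z z' ω, fun z z' => Dp z z' ω,
        fun d dp => Y d dp ω)) P)
    (hIV : ∀ᵐ ω ∂P, (∀ z, Di false z ω ≤ Di true z ω) ∧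
      ∀ zi j, Dp zi false ω j ≤ Dp zi true ω j)
    -- Assumption SM: monotonicity in the spillovers
    (hSM : ∀ᵐ ω ∂P, (∀ zi, Di zi false ω ≤ Di zi true ω) ∧
      ∀ z j, Dp false z ω j ≤ Dp true z ω j)
    -- Assumption IRR: irrelevance
    (hIRR : ∀ᵐ ω ∂P, (∀ z, Di true z ω = Di false z ω → Dp true z ω = Dp false z ω) ∧
      ∀ zi, Dp zi true ω = Dp zi false ω → Di zi true ω = Di zi false ω)
    -- SUTVA
    (hSUTVA : ∀ᵐ ω ∂P, ∀ z, Di z true ω = Di z false ω)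
    -- compliance-type events
    (Si Pi Gi : Set Ω)
    (hSi : Si = {ω | ∀ z z', Di z z' ω = (z || z')})
    (hPi : Pi = {ω | ∀ z z', Di z z' ω = z'})
    (hGi : Gi = {ω | ∀ z z', Di z z' ω = (z && z')}) :
    (dEM P Zi Zp (fun z z' ω => b2r (Di z z' ω)) false true false false =
        (P (Si ∪ Pi)).toReal ∧ P (Si ∪ Pi) = 0) ∧
    (dEM P Zi Zp (fun z z' ω => b2r (Di z z' ω)) true true true false =
        (P (Pi ∪ Gi)).toReal ∧ P (Pi ∪ Gi) = 0) := by
  have hDIndep : ∀ z z', IndepFun (fun ω => (Zi ω, Zp ω)) (Di z z') P := fun z z' =>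
    hIndep.comp (ψ := fun p : (Bool → Bool → Bool) × (Bool → Bool → Fin m → Bool) ×
      (Bool → (Fin m → Bool) → ℝ) => p.1 z z') measurable_id (by fun_prop)
  have hSP : P (Si ∪ Pi) = 0 := by
    refine measure_eq_zero_iff_ae_notMem.2 ?_
    filter_upwards [hSUTVA] with ω hω
    subst hSi hPi
    rintro (h | h) <;> simpa [h false true, h false false] using hω false
  have hPG : P (Pi ∪ Gi) = 0 := by
    refine measure_eq_zero_iff_ae_notMem.2 ?_
    filter_upwards [hSUTVA] with ω hω
    subst hPi hGi
    rintro (h | h) <;> simpa [h true true, h true false] using hω true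
  have hzero : ∀ z, dEM P Zi Zp (fun z z' ω => b2r (Di z z' ω)) z true z false = 0 := fun z =>
    dEM_b2r_eq_zero P hDi hDIndep hZpos (hSUTVA.mono fun _ hω => hω z)
  simp [hzero, hSP, hPG]

end
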